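/- arXiv:2109.12590 — 2 statements merged into one kernel-verified Lean document; each statement's English description precedes it below -/
import Mathlib

section
/- For every u = (u_1,…,u_l) ∈ ∏_{j=1}^l ℂ^{k_j} and every η with 0 < |η| < π, the Jacobian determinant of Ψ at (u,η) equals J(u,η) = Σ_{j=1}^l [∏_{i ≠ j} (2 − 2cos(2a_iη))^{k_i}] · 8a_j²|u_j|² (2 − 2cos(2a_jη) − 2a_jη sin(2a_jη)) (2 − 2cos(2a_jη))^{k_j−1}. -/
open MeasureTheory Real Complex Finset Filter Topology

noncomputable section

/-- The underlying space of the nonisotropic Heisenberg group `ℍ(𝒦,𝒜)`, where the number of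
blocks is `l + 1`, the block dimensions are `k 0, …, k l` and the parameters are
`a 0 < ⋯ < a l`. A point is a pair `(z, t)` with `z i : Fin (k i) → ℂ` and `t : ℝ`. -/
abbrev Heis (l : ℕ) (k : Fin (l + 1) → ℕ) : Type :=
  ((i : Fin (l + 1)) → (Fin (k i) → ℂ)) × ℝ

variable (l : ℕ) (k : Fin (l + 1) → ℕ) (a : Fin (l + 1) → ℝ)

/-- The group multiplication of `ℍ(𝒦,𝒜)`:
`(z,t)·(z′,t′) = (z + z′, t + t′ + 2 ∑ᵢ aᵢ Im⟨zᵢ, zᵢ′⟩)`. -/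
def hmul (g g' : Heis l k) : Heis l k :=
  (g.1 + g'.1,
    g.2 + g'.2 + 2 * ∑ i, a i * (∑ j, (starRingEnd ℂ) (g.1 i j) * g'.1 i j).im)

/-- The group inversion of `ℍ(𝒦,𝒜)`: `(z,t)⁻¹ = (-z,-t)`. -/
def hinv (g : Heis l k) : Heis l k := (-g.1, -g.2)

/-- `|z i|²`, the squared Euclidean norm of the `i`-th block of `z`. -/
def zNormSq (z : (i : Fin (l + 1)) → Fin (k i) → ℂ) (i : Fin (l + 1)) : ℝ :=
  ∑ j, Complex.normSq (z i j)

/-- The left-invariant vector field `X_{i,j} = ∂_{x_{i,j}} + 2 aᵢ y_{i,j} ∂_t`, applied to a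
function `f` at a point `g`, realized as a directional (line) derivative. -/
def Xvf (i : Fin (l + 1)) (j : Fin (k i)) (f : Heis l k → ℝ) (g : Heis l k) : ℝ :=
  lineDeriv ℝ f g (Pi.single i (Pi.single j (1 : ℂ)), 2 * a i * (g.1 i j).im)

/-- The left-invariant vector field `Y_{i,j} = ∂_{y_{i,j}} - 2 aᵢ x_{i,j} ∂_t`. -/
def Yvf (i : Fin (l + 1)) (j : Fin (k i)) (f : Heis l k → ℝ) (g : Heis l k) : ℝ :=
  lineDeriv ℝ f g (Pi.single i (Pi.single j (Complex.I)), -(2 * a i * (g.1 i j).re))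

/-- The right-invariant vector field `X̂_{i,j} = ∂_{x_{i,j}} - 2 aᵢ y_{i,j} ∂_t`. -/
def XvfR (i : Fin (l + 1)) (j : Fin (k i)) (f : Heis l k → ℝ) (g : Heis l k) : ℝ :=
  lineDeriv ℝ f g (Pi.single i (Pi.single j (1 : ℂ)), -(2 * a i * (g.1 i j).im))

/-- The right-invariant vector field `Ŷ_{i,j} = ∂_{y_{i,j}} + 2 aᵢ x_{i,j} ∂_t`. -/
def YvfR (i : Fin (l + 1)) (j : Fin (k i)) (f : Heis l k → ℝ) (g : Heis l k) : ℝ :=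
  lineDeriv ℝ f g (Pi.single i (Pi.single j (Complex.I)), 2 * a i * (g.1 i j).re)

/-- `|∇f|(g)`, the Euclidean length of the horizontal (left-invariant) gradient of `f` at `g`. -/
def gradNorm (f : Heis l k → ℝ) (g : Heis l k) : ℝ :=
  Real.sqrt (∑ i, ∑ j, ((Xvf l k a i j f g) ^ 2 + (Yvf l k a i j f g) ^ 2))

/-- The heat kernel `p_h(z,t)` at time `h` of `ℍ(𝒦,𝒜)`, as a complex integral:
`p_h(z,t) = (2(4πh)^{n+1})⁻¹ ∫_ℝ ∏ⱼ (aⱼλ/sinh(aⱼλ))^{kⱼ}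
  exp((4h)⁻¹(iλt − ∑ⱼ |zⱼ|² aⱼλ coth(aⱼλ))) dλ`. -/
def heatKernelC (h : ℝ) (g : Heis l k) : ℂ :=
  (2 * (4 * Real.pi * h) ^ ((∑ i, k i) + 1) : ℂ)⁻¹ *
    ∫ lam : ℝ,
      ((∏ j, ((a j * lam) / Real.sinh (a j * lam)) ^ (k j) : ℝ) : ℂ) *
        Complex.exp ((4 * (h : ℂ))⁻¹ *
          (Complex.I * (lam : ℂ) * (g.2 : ℂ) -
            ∑ j, ((zNormSq l k g.1 j : ℝ) : ℂ) *
              ((a j * lam * (Real.cosh (a j * lam) / Real.sinh (a j * lam)) : ℝ) : ℂ)))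

/-- The (real-valued) heat kernel `p_h` of `ℍ(𝒦,𝒜)`. -/
def heatKernel (h : ℝ) (g : Heis l k) : ℝ := (heatKernelC l k a h g).re

/-- The heat semigroup: `e^{hΔ} f (g) = ∫_ℍ f(g·g′) p_h(g′) dm(g′)`, with `m` the Lebesgue
(Haar) measure on `ℍ(𝒦,𝒜)`. -/
def heatSemigroup (h : ℝ) (f : Heis l k → ℝ) (g : Heis l k) : ℝ :=
  ∫ g' : Heis l k, f (hmul l k a g g') * heatKernel l k a h g'

/-- `μ(ω) = (2ω − sin 2ω)/(2 sin²ω)`; note that at `ω = 0` Lean's convention `0/0 = 0`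
gives exactly the continuous extension `μ(0) = 0`. -/
def muF (ω : ℝ) : ℝ := (2 * ω - Real.sin (2 * ω)) / (2 * Real.sin ω ^ 2)

/-- `x / sin x`, extended continuously by `1` at `x = 0`. -/
def sdiv (x : ℝ) : ℝ := if x = 0 then 1 else x / Real.sin x

/-- The angle `θ(z,t) ∈ (−π,π)` solving `t = ∑ⱼ aⱼ μ(aⱼθ)|zⱼ|²`, chosen by the epsilon
operator (whenever a solution exists it is unique, and `thetaOf` is that solution). -/
def thetaOf (g : Heis l k) : ℝ :=
  Classical.epsilon fun θ : ℝ => θ ∈ Set.Ioo (-Real.pi) Real.pi ∧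
    g.2 = ∑ j, a j * muF (a j * θ) * zNormSq l k g.1 j

/-- The squared Carnot–Carathéodory distance from `g = (z,t)` to the origin:
if `z_l ≠ 0`, or `z_l = 0` and `|t| < ∑_{j<l} aⱼ μ(aⱼπ)|zⱼ|²`, it is
`∑ⱼ (aⱼθ/sin(aⱼθ))² |zⱼ|²` with `θ = θ(z,t)`; otherwise it is
`π(|t| + ∑_{j<l} aⱼ cot(aⱼπ)|zⱼ|²)`. -/
def ccDistSq (g : Heis l k) : ℝ :=
  if g.1 (Fin.last l) ≠ 0 ∨
      |g.2| < ∑ j ∈ Finset.univ.erase (Fin.last l),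
        a j * muF (a j * Real.pi) * zNormSq l k g.1 j then
    ∑ j, (sdiv (a j * thetaOf l k a g)) ^ 2 * zNormSq l k g.1 j
  else
    Real.pi * (|g.2| + ∑ j ∈ Finset.univ.erase (Fin.last l),
      a j * (Real.cos (a j * Real.pi) / Real.sin (a j * Real.pi)) * zNormSq l k g.1 j)

/-- The Carnot–Carathéodory distance from `g` to the origin. -/
def ccDist (g : Heis l k) : ℝ := Real.sqrt (ccDistSq l k a g)

/-- The Carnot–Carathéodory unit ball `B` of `ℍ(𝒦,𝒜)`. -/
def ballCC : Set (Heis l k) := {g | ccDist l k a g < 1}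

/-- `m_f`, the mean of `f` over the Carnot–Carathéodory unit ball. -/
def meanB (f : Heis l k → ℝ) : ℝ :=
  (∫ g in ballCC l k a, f g) / (volume (ballCC l k a)).toReal

/-- The polar coordinates map
`Ψ(u,η) = ((1−e^{−2ia₁η})u₁, …, (1−e^{−2ia_lη})u_l, ∑ⱼ 2aⱼ|uⱼ|²(2aⱼη − sin(2aⱼη)))`. -/
def Psi (u : (i : Fin (l + 1)) → Fin (k i) → ℂ) (η : ℝ) : Heis l k :=
  (fun i => fun j => (1 - Complex.exp (-(2 * Complex.I * (a i : ℂ) * (η : ℂ)))) * u i j,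
    ∑ j, 2 * a j * zNormSq l k u j * (2 * a j * η - Real.sin (2 * a j * η)))

/-- `U = (4 ∑ⱼ aⱼ²|uⱼ|²)^{1/2}`. -/
def Ufun (u : (i : Fin (l + 1)) → Fin (k i) → ℂ) : ℝ :=
  Real.sqrt (4 * ∑ j, (a j) ^ 2 * zNormSq l k u j)

/-- The Jacobian determinant `J(u,η)` of `Ψ` at `(u,η)` (the determinant of the total
derivative of `Ψ` as a map of the real vector space `ℍ ≅ ℝ^{2n+1}`). -/
def jacPsi (u : (i : Fin (l + 1)) → Fin (k i) → ℂ) (η : ℝ) : ℝ :=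
  LinearMap.det
    ((fderiv ℝ (fun q : Heis l k => Psi l k a q.1 q.2) (u, η)) : Heis l k →ₗ[ℝ] Heis l k)


lemma det_mulBlock (c : Fin (l + 1) → ℂ) (C : ((i : Fin (l + 1)) → Fin (k i) → ℂ) →ₗ[ℝ]
    ((i : Fin (l + 1)) → Fin (k i) → ℂ)) (hC : ∀ v i j, C v i j = c i * v i j) :
    LinearMap.det C = ∏ i, (Complex.normSq (c i)) ^ (k i) := by
  let e := LinearEquiv.piCurry ℝ (fun (i : Fin (l + 1)) (_ : Fin (k i)) => ℂ)
  let f : (p : (i : Fin (l + 1)) × Fin (k i)) → ℂ →ₗ[ℝ] ℂ := fun p => LinearMap.mulLeft ℝ (c p.1)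
  have h : C = e.toLinearMap ∘ₗ (LinearMap.pi (fun p ↦ (f p).comp (LinearMap.proj p))) ∘ₗ
      e.symm.toLinearMap := by
    refine LinearMap.ext fun v => ?_
    funext i j
    rw [hC]
    rfl
  have hn : ∀ z : ℂ, LinearMap.det (LinearMap.mulLeft ℝ z) = Complex.normSq z := fun z => by
    rw [← Algebra.norm_complex_apply]; rfl
  rw [h, LinearMap.det_conj, LinearMap.det_pi, Fintype.prod_sigma]
  simp [f, hn]

lemma det_block {V : Type*} [AddCommGroup V] [Module ℝ V] [Module.Finite ℝ V]
    (D : V × ℝ →ₗ[ℝ] V × ℝ) (C : V →ₗ[ℝ] V) (w w' : V) (r r' : V →ₗ[ℝ] ℝ) (d : ℝ)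
    (hD : ∀ v s, D (v, s) = (C v + s • w, r v + s * d))
    (hw : C w' = w) (hr : ∀ v, r' (C v) = r v) :
    LinearMap.det D = LinearMap.det C * (d - r w') := by
  have h : D = LinearMap.transvection (r' ∘ₗ LinearMap.fst ℝ V ℝ) (0, 1) ∘ₗ
      (LinearMap.prodMap C ((d - r w') • LinearMap.id)) ∘ₗ
      LinearMap.transvection (LinearMap.snd ℝ V ℝ) (w', 0) := by
    refine LinearMap.ext fun x => ?_
    obtain ⟨v, s⟩ := x
    rw [hD]
    simp [LinearMap.transvection.apply, hw, ← hr]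
    ring
  rw [h, LinearMap.det_comp, LinearMap.det_comp, LinearMap.det_prodMap,
    LinearMap.transvection.det, LinearMap.transvection.det]
  simp

lemma hasDerivAt_line (u v : (i : Fin (l + 1)) → Fin (k i) → ℂ) (η s : ℝ) :
    HasDerivAt (fun t : ℝ => Psi l k a (u + t • v) (η + t • s))
      ((fun i j => (1 - Complex.exp (-(2 * Complex.I * (a i : ℂ) * (η : ℂ)))) * v i j +
          s • (2 * Complex.I * a i * Complex.exp (-(2 * Complex.I * (a i : ℂ) * (η : ℂ))) * u i j)),
        (∑ j, 4 * a j * (2 * a j * η - Real.sin (2 * a j * η)) *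
          ∑ m, ((u j m).re * (v j m).re + (u j m).im * (v j m).im)) +
        s * ∑ j, 4 * (a j) ^ 2 * zNormSq l k u j * (1 - Real.cos (2 * a j * η))) 0 := by
  unfold Psi
  have hη : HasDerivAt (fun t : ℝ => η + t • s) s 0 := by
    simpa using ((hasDerivAt_id (0 : ℝ)).smul_const s).const_add η
  refine HasDerivAt.prodMk ?_ ?_
  · rw [hasDerivAt_pi]; intro i
    rw [hasDerivAt_pi]; intro j
    have h1 : HasDerivAt (fun t : ℝ => ((η + t • s : ℝ) : ℂ)) (s : ℂ) 0 := hη.ofReal_comp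
    have h2 := ((h1.const_mul (2 * Complex.I * (a i : ℂ))).fun_neg.cexp).const_sub 1
    have h3 : HasDerivAt (fun t : ℝ => (u + t • v) i j) (v i j) 0 := by
      simpa using ((hasDerivAt_id (0 : ℝ)).smul_const (v i j)).const_add (u i j)
    refine (h2.fun_mul h3).congr_deriv ?_
    simp
    ring
  · have hz : ∀ j, HasDerivAt (fun t : ℝ => zNormSq l k (u + t • v) j)
        (2 * ∑ m, ((u j m).re * (v j m).re + (u j m).im * (v j m).im)) 0 := by
      intro j
      unfold zNormSq
      rw [Finset.mul_sum]
      refine HasDerivAt.fun_sum fun m _ => ?_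
      have hre : HasDerivAt (fun t : ℝ => (u j m).re + t * (v j m).re) (v j m).re 0 := by
        simpa using ((hasDerivAt_id (0 : ℝ)).mul_const (v j m).re).const_add (u j m).re
      have him : HasDerivAt (fun t : ℝ => (u j m).im + t * (v j m).im) (v j m).im 0 := by
        simpa using ((hasDerivAt_id (0 : ℝ)).mul_const (v j m).im).const_add (u j m).im
      convert (hre.fun_mul hre).fun_add (him.fun_mul him) using 1
      · funext t
        simp [Complex.normSq_apply]
      · simp
        ring
    rw [Finset.mul_sum, ← Finset.sum_add_distrib]
    refine HasDerivAt.fun_sum fun j _ => ?_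
    have h4 := hη.const_mul (2 * a j)
    refine (((hz j).const_mul (2 * a j)).fun_mul (h4.fun_sub h4.sin)).congr_deriv ?_
    simp
    ring

lemma differentiable_Psi : Differentiable ℝ (fun q : Heis l k => Psi l k a q.1 q.2) := by
  unfold Psi zNormSq
  simp only [Complex.normSq_apply]
  refine Differentiable.prodMk ?_ ?_
  · rw [differentiable_pi]; intro i
    rw [differentiable_pi]; intro j
    have h1 : Differentiable ℝ (fun q : Heis l k => ((q.2 : ℝ) : ℂ)) :=
      Complex.ofRealCLM.differentiable.comp differentiable_snd
    fun_prop
  · have hre : ∀ i j, Differentiable ℝ (fun q : Heis l k => (q.1 i j).re) := fun i j =>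
      Complex.reCLM.differentiable.comp (by fun_prop)
    have him : ∀ i j, Differentiable ℝ (fun q : Heis l k => (q.1 i j).im) := fun i j =>
      Complex.imCLM.differentiable.comp (by fun_prop)
    fun_prop

lemma fderiv_Psi (u v : (i : Fin (l + 1)) → Fin (k i) → ℂ) (η s : ℝ) :
    fderiv ℝ (fun q : Heis l k => Psi l k a q.1 q.2) (u, η) (v, s) =
      ((fun i j => (1 - Complex.exp (-(2 * Complex.I * (a i : ℂ) * (η : ℂ)))) * v i j +
          s • (2 * Complex.I * a i * Complex.exp (-(2 * Complex.I * (a i : ℂ) * (η : ℂ))) * u i j)),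
        (∑ j, 4 * a j * (2 * a j * η - Real.sin (2 * a j * η)) *
          ∑ m, ((u j m).re * (v j m).re + (u j m).im * (v j m).im)) +
        s * ∑ j, 4 * (a j) ^ 2 * zNormSq l k u j * (1 - Real.cos (2 * a j * η))) := by
  have h := (differentiable_Psi l k a (u, η)).hasFDerivAt.hasLineDerivAt (v, s)
  exact HasDerivAt.unique h (hasDerivAt_line l k a u v η s)

/-- The first-block part. -/
def Cmap (c : Fin (l + 1) → ℂ) : ((i : Fin (l + 1)) → Fin (k i) → ℂ) →ₗ[ℝ]
    ((i : Fin (l + 1)) → Fin (k i) → ℂ) where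
  toFun v := fun i j => c i * v i j
  map_add' v w := by funext i j; simp [mul_add]
  map_smul' t v := by funext i j; simp; ring

/-- The last row. -/
def rmap (b : Fin (l + 1) → ℝ) (u : (i : Fin (l + 1)) → Fin (k i) → ℂ) :
    ((i : Fin (l + 1)) → Fin (k i) → ℂ) →ₗ[ℝ] ℝ where
  toFun v := ∑ j, b j * ∑ m, ((u j m).re * (v j m).re + (u j m).im * (v j m).im)
  map_add' v w := by
    rw [← Finset.sum_add_distrib]
    refine Finset.sum_congr rfl fun j _ => ?_
    rw [← mul_add, ← Finset.sum_add_distrib]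
    congr 1
    refine Finset.sum_congr rfl fun m _ => ?_
    simp; ring
  map_smul' t v := by
    simp only [RingHom.id_apply, smul_eq_mul, Finset.mul_sum]
    refine Finset.sum_congr rfl fun j _ => ?_
    refine Finset.sum_congr rfl fun m _ => ?_
    simp; ring

lemma c_eq (x y : ℝ) : (1 - Complex.exp (-(2 * Complex.I * (x : ℂ) * (y : ℂ)))) =
    ⟨1 - Real.cos (2 * x * y), Real.sin (2 * x * y)⟩ := by
  have : (-(2 * Complex.I * (x : ℂ) * (y : ℂ))) = ((-(2 * x * y) : ℝ) : ℂ) * Complex.I := by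
    push_cast; ring
  rw [this]
  apply Complex.ext
  · rw [Complex.sub_re, Complex.exp_ofReal_mul_I_re]; simp
  · rw [Complex.sub_im, Complex.exp_ofReal_mul_I_im]; simp

lemma e_eq (x y : ℝ) : Complex.exp (-(2 * Complex.I * (x : ℂ) * (y : ℂ))) =
    ⟨Real.cos (2 * x * y), -Real.sin (2 * x * y)⟩ := by
  have h := c_eq x y
  have h2 : Complex.exp (-(2 * Complex.I * (x : ℂ) * (y : ℂ))) = 1 -
    ⟨1 - Real.cos (2 * x * y), Real.sin (2 * x * y)⟩ := by rw [← h]; ring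
  rw [h2]
  apply Complex.ext <;> simp

lemma normSq_c (x y : ℝ) : Complex.normSq (1 - Complex.exp (-(2 * Complex.I * (x : ℂ) * (y : ℂ)))) =
    2 - 2 * Real.cos (2 * x * y) := by
  rw [c_eq, Complex.normSq_mk]
  nlinarith [Real.sin_sq_add_cos_sq (2 * x * y)]

lemma re_ratio (x y : ℝ) :
    (2 * Complex.I * x * Complex.exp (-(2 * Complex.I * (x : ℂ) * (y : ℂ))) /
      (1 - Complex.exp (-(2 * Complex.I * (x : ℂ) * (y : ℂ))))).re =
    2 * x * Real.sin (2 * x * y) / (2 - 2 * Real.cos (2 * x * y)) := by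
  rw [Complex.div_re, normSq_c, c_eq, e_eq]
  simp
  ring

/-- For every `u` and every `η` with `0 < |η| < π`, the Jacobian determinant
of `Ψ` at `(u,η)` equals
`J(u,η) = ∑ⱼ [∏_{i≠j} (2−2cos(2aᵢη))^{kᵢ}] ⬝ 8aⱼ²|uⱼ|² (2−2cos(2aⱼη) − 2aⱼη sin(2aⱼη))
  (2−2cos(2aⱼη))^{kⱼ−1}`. -/
theorem statement8 (l : ℕ) (k : Fin (l + 1) → ℕ) (hk : ∀ i, 0 < k i)
    (a : Fin (l + 1) → ℝ) (ha0 : 0 < a 0) (haMono : StrictMono a)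
    (haLast : a (Fin.last l) = 1)
    (u : (i : Fin (l + 1)) → Fin (k i) → ℂ) (η : ℝ) (hη0 : 0 < |η|) (hηπ : |η| < Real.pi) :
    jacPsi l k a u η =
      ∑ j, (∏ i ∈ Finset.univ.erase j, (2 - 2 * Real.cos (2 * a i * η)) ^ (k i)) *
        (8 * (a j) ^ 2 * zNormSq l k u j *
          (2 - 2 * Real.cos (2 * a j * η) - 2 * a j * η * Real.sin (2 * a j * η)) *
          (2 - 2 * Real.cos (2 * a j * η)) ^ (k j - 1)) := by
  have hpos : ∀ i, 2 - 2 * Real.cos (2 * a i * η) ≠ 0 := by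
    intro i hc
    have hai : 0 < a i := lt_of_lt_of_le ha0 (haMono.monotone (Fin.zero_le i))
    have hai1 : a i ≤ 1 := haLast ▸ haMono.monotone (Fin.le_last i)
    have hη : η ≠ 0 := abs_pos.mp hη0
    have hb : |2 * a i * η| < 2 * Real.pi := by
      rw [abs_mul, abs_of_pos (by positivity : 0 < 2 * a i)]
      nlinarith
    have hb' := abs_lt.mp hb
    have := (Real.cos_eq_one_iff_of_lt_of_lt hb'.1 hb'.2).mp (by linarith)
    have h2 : 2 * a i ≠ 0 := by positivity
    exact (mul_ne_zero h2 hη) this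
  set c : Fin (l + 1) → ℂ := fun i => 1 - Complex.exp (-(2 * Complex.I * (a i : ℂ) * (η : ℂ)))
    with hcdef
  have hc0 : ∀ i, c i ≠ 0 := fun i h => hpos i (by rw [← normSq_c]; simpa [hcdef] using h)
  set c' : Fin (l + 1) → ℂ := fun i =>
    2 * Complex.I * a i * Complex.exp (-(2 * Complex.I * (a i : ℂ) * (η : ℂ))) with hc'def
  set b : Fin (l + 1) → ℝ := fun j => 4 * a j * (2 * a j * η - Real.sin (2 * a j * η)) with hb
  have hdet := det_block (fderiv ℝ (fun q : Heis l k => Psi l k a q.1 q.2) (u, η) :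
      Heis l k →ₗ[ℝ] Heis l k) (Cmap l k c) (Cmap l k c' u) (Cmap l k (fun i => c' i / c i) u)
      (rmap l k b u) (rmap l k b u ∘ₗ Cmap l k (fun i => (c i)⁻¹))
      (∑ j, 4 * (a j) ^ 2 * zNormSq l k u j * (1 - Real.cos (2 * a j * η)))
      (fun v s => fderiv_Psi l k a u v η s)
      (by
        funext i j
        show c i * (c' i / c i * u i j) = c' i * u i j
        have := hc0 i
        field_simp)
      (by
        intro v
        show rmap l k b u (Cmap l k (fun i => (c i)⁻¹) (Cmap l k c v)) = _
        congr 1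
        funext i j
        show (c i)⁻¹ * (c i * v i j) = v i j
        have := hc0 i
        field_simp)
  have hr : rmap l k b u (Cmap l k (fun i => c' i / c i) u) =
      ∑ j, b j * ((2 * a j * Real.sin (2 * a j * η) / (2 - 2 * Real.cos (2 * a j * η))) *
        zNormSq l k u j) := by
    show ∑ j, b j * ∑ m, ((u j m).re * (c' j / c j * u j m).re +
      (u j m).im * (c' j / c j * u j m).im) = _
    refine Finset.sum_congr rfl fun j _ => ?_
    congr 1
    rw [← re_ratio]
    unfold zNormSq
    rw [Finset.mul_sum]
    refine Finset.sum_congr rfl fun m _ => ?_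
    rw [Complex.mul_re, Complex.mul_im, Complex.normSq_apply]
    ring
  unfold jacPsi
  rw [hdet, hr, det_mulBlock l k c _ (fun v i j => rfl), ← Finset.sum_sub_distrib, Finset.mul_sum]
  refine Finset.sum_congr rfl fun j _ => ?_
  rw [← Finset.mul_prod_erase _ _ (Finset.mem_univ j)]
  simp only [hcdef, normSq_c]
  have hkj : (2 - 2 * Real.cos (2 * a j * η)) ^ (k j) =
      (2 - 2 * Real.cos (2 * a j * η)) ^ (k j - 1) * (2 - 2 * Real.cos (2 * a j * η)) := by
    rw [← pow_succ, Nat.sub_add_cancel (hk j)]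
  rw [hkj]
  generalize (∏ i ∈ Finset.univ.erase j, (2 - 2 * Real.cos (2 * a i * η)) ^ (k i)) = P
  generalize (2 - 2 * Real.cos (2 * a j * η)) ^ (k j - 1) = Q
  have hp := hpos j
  have hsc := Real.sin_sq_add_cos_sq (2 * a j * η)
  simp only [hb]
  have key : (2 - 2 * Real.cos (2 * a j * η)) *
      (4 * a j ^ 2 * zNormSq l k u j * (1 - Real.cos (2 * a j * η)) -
        4 * a j * (2 * a j * η - Real.sin (2 * a j * η)) *
          (2 * a j * Real.sin (2 * a j * η) / (2 - 2 * Real.cos (2 * a j * η)) *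
            zNormSq l k u j)) =
      8 * (a j) ^ 2 * zNormSq l k u j *
          (2 - 2 * Real.cos (2 * a j * η) - 2 * a j * η * Real.sin (2 * a j * η)) := by
    have e1 : (2 - 2 * Real.cos (2 * a j * η)) * (2 * a j * Real.sin (2 * a j * η) /
      (2 - 2 * Real.cos (2 * a j * η))) = 2 * a j * Real.sin (2 * a j * η) :=
      mul_div_cancel₀ _ hp
    linear_combination (-4 * a j * (2 * a j * η - Real.sin (2 * a j * η)) * zNormSq l k u j) * e1
      + 8 * a j ^ 2 * zNormSq l k u j * hsc
  linear_combination P * Q * key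

end
end

section
/- For all u = (u_1,…,u_l) ∈ ∏_{j=1}^l ℂ^{k_j} and all η with 0 < |η| < π, the Jacobian determinant of Ψ satisfies the two-sided bound J(u,η) ∼ |η|^{2n+2} (π − |η|)^{2k_l − 1} (|u′|²(π − |η|) + |u_l|²), where u′ = (u_1,…,u_{l−1}) and the implied constants depend only on (𝒦,𝒜). -/
open MeasureTheory Real Complex Finset Filter Topology

noncomputable section

variable (l : ℕ) (k : Fin (l + 1) → ℕ) (a : Fin (l + 1) → ℝ)

lemma det_aux9 {V : Type*} [AddCommGroup V] [Module ℝ V] [Module.Finite ℝ V]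
    (L : (V × ℝ) →ₗ[ℝ] (V × ℝ)) (A B : V →ₗ[ℝ] V) (hAB : ∀ v, A (B v) = v)
    (hBA : ∀ v, B (A v) = v) (b : V) (hL : ∀ v s, (L (v, s)).1 = A v + s • b) :
    LinearMap.det L = LinearMap.det A * (L (-(B b), 1)).2 := by
  set δ : ℝ := (L (-(B b), 1)).2 with hδ
  let c : V →ₗ[ℝ] ℝ := LinearMap.snd ℝ V ℝ ∘ₗ L ∘ₗ LinearMap.inl ℝ V ℝ
  let T1 : (V × ℝ) →ₗ[ℝ] (V × ℝ) :=
    LinearMap.transvection (c ∘ₗ B ∘ₗ LinearMap.fst ℝ V ℝ) ((0 : V), (1 : ℝ))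
  let T2 : (V × ℝ) →ₗ[ℝ] (V × ℝ) :=
    LinearMap.transvection (LinearMap.snd ℝ V ℝ) (B b, (0 : ℝ))
  have h1 : LinearMap.det T1 = 1 := by
    simp [T1, LinearMap.transvection.det]
  have h2 : LinearMap.det T2 = 1 := by
    simp [T2, LinearMap.transvection.det]
  have hdec : L = T1 ∘ₗ (LinearMap.prodMap A (δ • LinearMap.id)) ∘ₗ T2 := by
    apply LinearMap.ext
    rintro ⟨v, s⟩
    have e2 : (L (v, s)).2 = c v + s * (δ + c (B b)) := by
      have : (v, s) = (v, (0 : ℝ)) + s • ((-(B b), (1 : ℝ)) + (B b, (0 : ℝ))) := by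
        ext <;> simp
      rw [this, map_add, map_smul, map_add]
      simp [c, hδ]
      ring
    apply Prod.ext
    · rw [hL]
      simp [T1, T2, LinearMap.transvection.apply, hAB]
    · rw [e2]
      simp [T1, T2, LinearMap.transvection.apply, hAB, hBA]
      ring
  rw [hdec, LinearMap.det_comp, LinearMap.det_comp, h1, h2, LinearMap.det_prodMap]
  simp

/-- blockwise complex multiplication -/
def blockMul (l : ℕ) (k : Fin (l + 1) → ℕ) (α : Fin (l + 1) → ℂ) :
    ((i : Fin (l + 1)) → Fin (k i) → ℂ) →ₗ[ℝ] ((i : Fin (l + 1)) → Fin (k i) → ℂ) where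
  toFun v := fun i j => α i * v i j
  map_add' v w := by ext i j; simp [mul_add]
  map_smul' r v := by ext i j; simp; ring

lemma det_blockMul (l : ℕ) (k : Fin (l + 1) → ℕ) (α : Fin (l + 1) → ℂ) :
    LinearMap.det (blockMul l k α) = ∏ i, (Complex.normSq (α i)) ^ (k i) := by
  let e := (LinearEquiv.piCurry ℝ (fun (i : Fin (l + 1)) (_ : Fin (k i)) => ℂ)).symm
  rw [← LinearMap.det_conj _ e]
  have : (e : _ →ₗ[ℝ] _) ∘ₗ blockMul l k α ∘ₗ (e.symm : _ →ₗ[ℝ] _) =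
      LinearMap.pi (fun p : (i : Fin (l + 1)) × Fin (k i) =>
        (LinearMap.mulLeft ℝ (α p.1)).comp (LinearMap.proj p)) := by
    ext v p
    all_goals rfl
  rw [this, LinearMap.det_pi]
  have h : ∀ z : ℂ, LinearMap.det (LinearMap.mulLeft ℝ z) = Complex.normSq z := by
    intro z
    rw [← Algebra.norm_complex_apply]; rfl
  simp only [h]
  rw [Fintype.prod_sigma]
  simp

lemma alpha_eq (x : ℝ) (z : ℂ) (hz : z = -(2 * Complex.I * x)) :
    Complex.exp z = ((Real.cos (2 * x) : ℝ) : ℂ) - Complex.I * ((Real.sin (2 * x) : ℝ) : ℂ) := by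
  have : z = ((-(2 * x) : ℝ) : ℂ) * Complex.I := by rw [hz]; push_cast; ring
  rw [this, Complex.exp_mul_I, ← Complex.ofReal_cos, ← Complex.ofReal_sin, Real.cos_neg,
    Real.sin_neg]
  push_cast; ring

lemma psi_diff (l : ℕ) (k : Fin (l + 1) → ℕ) (a : Fin (l + 1) → ℝ) :
    Differentiable ℝ (fun q : Heis l k => Psi l k a q.1 q.2) := by
  unfold Psi zNormSq
  simp only [Complex.normSq_apply]
  apply Differentiable.prodMk
  · rw [differentiable_pi]; intro i
    rw [differentiable_pi]; intro j
    have h1 : Differentiable ℝ (fun q : Heis l k => (q.2 : ℂ)) :=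
      Complex.ofRealCLM.differentiable.comp differentiable_snd
    fun_prop
  · have hre : ∀ i j, Differentiable ℝ (fun q : Heis l k => (q.1 i j).re) := fun i j =>
      Complex.reCLM.differentiable.comp (by fun_prop)
    have him : ∀ i j, Differentiable ℝ (fun q : Heis l k => (q.1 i j).im) := fun i j =>
      Complex.imCLM.differentiable.comp (by fun_prop)
    fun_prop

lemma psi_line (l : ℕ) (k : Fin (l + 1) → ℕ) (a : Fin (l + 1) → ℝ)
    (u v : (i : Fin (l + 1)) → Fin (k i) → ℂ) (η s : ℝ) :
    HasDerivAt (fun t : ℝ => Psi l k a (u + t • v) (η + t * s))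
      (fderiv ℝ (fun q : Heis l k => Psi l k a q.1 q.2) (u, η) (v, s)) 0 := by
  have h := (psi_diff l k a (u, η)).hasFDerivAt
  have hl : HasDerivAt (fun t : ℝ => ((u + t • v, η + t * s) : Heis l k)) (v, s) 0 := by
    apply HasDerivAt.prodMk
    · simpa using ((hasDerivAt_id (0:ℝ)).smul_const v).const_add u
    · simpa using ((hasDerivAt_id (0:ℝ)).mul_const s).const_add η
  have h' : HasFDerivAt (fun q : Heis l k => Psi l k a q.1 q.2)
    (fderiv ℝ (fun q : Heis l k => Psi l k a q.1 q.2) (u, η))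
      ((fun t : ℝ => ((u + t • v, η + t * s) : Heis l k)) 0) := by simpa using h
  exact h'.comp_hasDerivAt (0:ℝ) hl

lemma psi_fst (l : ℕ) (k : Fin (l + 1) → ℕ) (a : Fin (l + 1) → ℝ)
    (u v : (i : Fin (l + 1)) → Fin (k i) → ℂ) (η s : ℝ) :
    (fderiv ℝ (fun q : Heis l k => Psi l k a q.1 q.2) (u, η) (v, s)).1 =
      blockMul l k (fun i => 1 - Complex.exp (-(2 * Complex.I * (a i : ℂ) * (η : ℂ)))) v +
      s • (fun i j => 2 * Complex.I * a i *
        Complex.exp (-(2 * Complex.I * (a i : ℂ) * (η : ℂ))) * u i j) := by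
  have h := psi_line l k a u v η s
  ext i j
  have h1 : HasDerivAt (fun t : ℝ => (Psi l k a (u + t • v) (η + t * s)).1 i j)
     ((fderiv ℝ (fun q : Heis l k => Psi l k a q.1 q.2) (u, η) (v, s)).1 i j) 0 := by
    have := (ContinuousLinearMap.fst ℝ ((i : Fin (l + 1)) → Fin (k i) → ℂ) ℝ).hasFDerivAt.comp_hasDerivAt (0:ℝ) h
    exact hasDerivAt_pi.1 (hasDerivAt_pi.1 this i) j
  refine h1.unique ?_
  have h2 : HasDerivAt (fun t : ℝ => ((η + t * s : ℝ) : ℂ)) (s : ℂ) 0 := by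
    have := ((hasDerivAt_id (0:ℝ)).mul_const s).const_add η
    simpa using this.ofReal_comp
  have h3 : HasDerivAt (fun t : ℝ => (u + t • v) i j) (v i j) 0 := by
    simpa using ((hasDerivAt_id (0:ℝ)).smul_const (v i j)).const_add (u i j)
  have h4 := ((((h2.const_mul (2 * Complex.I * (a i : ℂ))).neg).cexp).const_sub 1).mul h3
  refine h4.congr_deriv ?_
  simp [blockMul]
  ring

lemma psi_snd (l : ℕ) (k : Fin (l + 1) → ℕ) (a : Fin (l + 1) → ℝ)
    (u : (i : Fin (l + 1)) → Fin (k i) → ℂ) (η : ℝ) (w : Fin (l + 1) → ℂ) :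
    (fderiv ℝ (fun q : Heis l k => Psi l k a q.1 q.2) (u, η)
      (fun i j => - (w i * u i j), 1)).2 =
      ∑ j, (zNormSq l k u j * (2 * a j) *
        (2 * a j - 2 * a j * Real.cos (2 * a j * η)
          - 2 * (w j).re * (2 * a j * η - Real.sin (2 * a j * η)))) := by
  have h := psi_line l k a u (fun i j => - (w i * u i j)) η 1
  have h1 := (ContinuousLinearMap.snd ℝ ((i : Fin (l + 1)) → Fin (k i) → ℂ) ℝ).hasFDerivAt.comp_hasDerivAt (0:ℝ) h
  refine h1.unique ?_
  have : ∀ t : ℝ, ∀ j, zNormSq l k (u + t • (fun i j => - (w i * u i j))) j =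
      Complex.normSq (1 - t * w j) * zNormSq l k u j := by
    intro t j
    simp only [zNormSq, Finset.mul_sum, ← Complex.normSq_mul]
    refine Finset.sum_congr rfl fun m _ => ?_
    congr 1
    simp
    ring
  show HasDerivAt (fun t : ℝ => ∑ j, 2 * a j * zNormSq l k (u + t • (fun i j => - (w i * u i j))) j *
    (2 * a j * (η + t * 1) - Real.sin (2 * a j * (η + t * 1)))) _ 0
  simp only [this]
  refine HasDerivAt.fun_sum fun j _ => ?_
  have hη : HasDerivAt (fun t : ℝ => 2 * a j * (η + t * 1)) (2 * a j) 0 := by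
    simpa using (((hasDerivAt_id (0:ℝ)).mul_const 1).const_add η).const_mul (2 * a j)
  have hn : HasDerivAt (fun t : ℝ => Complex.normSq (1 - t * w j)) (-(2 * (w j).re)) 0 := by
    have e : ∀ t : ℝ, Complex.normSq (1 - t * w j) =
      (1 - t * (w j).re) * (1 - t * (w j).re) + (t * (w j).im) * (t * (w j).im) := by
      intro t; simp [Complex.normSq_apply]
    simp only [e]
    have hr := ((hasDerivAt_id (0:ℝ)).mul_const (w j).re).const_sub 1
    have hi := ((hasDerivAt_id (0:ℝ)).mul_const (w j).im)
    refine ((hr.mul hr).add (hi.mul hi)).congr_deriv ?_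
    simp; ring
  refine (((hn.mul_const (zNormSq l k u j)).const_mul (2 * a j)).mul (hη.sub hη.sin)).congr_deriv ?_
  simp
  ring

lemma jac_formula (l : ℕ) (k : Fin (l + 1) → ℕ) (a : Fin (l + 1) → ℝ)
    (u : (i : Fin (l + 1)) → Fin (k i) → ℂ) (η : ℝ) (hs : ∀ i, Real.sin (a i * η) ≠ 0) :
    jacPsi l k a u η = (∏ i, (4 * Real.sin (a i * η) ^ 2) ^ (k i)) *
      ∑ j, zNormSq l k u j * (8 * a j ^ 2 *
        ((Real.sin (a j * η) - a j * η * Real.cos (a j * η)) / Real.sin (a j * η))) := by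
  set α : Fin (l + 1) → ℂ := fun i => 1 - Complex.exp (-(2 * Complex.I * (a i : ℂ) * (η : ℂ))) with hα
  have hexp : ∀ i, Complex.exp (-(2 * Complex.I * (a i : ℂ) * (η : ℂ))) =
      ((Real.cos (2 * (a i * η)) : ℝ) : ℂ) - Complex.I * ((Real.sin (2 * (a i * η)) : ℝ) : ℂ) :=
    fun i => alpha_eq _ _ (by push_cast; ring)
  have hnorm : ∀ i, Complex.normSq (α i) = 4 * Real.sin (a i * η) ^ 2 := by
    intro i
    simp only [hα, hexp, Complex.normSq_apply]
    simp only [Complex.sub_re, Complex.sub_im, Complex.mul_re, Complex.mul_im, Complex.I_re,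
      Complex.I_im, Complex.ofReal_re, Complex.ofReal_im, Complex.one_re, Complex.one_im]
    rw [Real.cos_two_mul, Real.sin_two_mul]
    have := Real.sin_sq_add_cos_sq (a i * η)
    have h2 : Real.cos (a i * η) ^ 2 = 1 - Real.sin (a i * η) ^ 2 := by linarith
    ring_nf
    rw [show Real.cos (a i * η) ^ 4 = (Real.cos (a i * η) ^ 2) ^ 2 by ring, h2]
    ring
  have hα0 : ∀ i, α i ≠ 0 := by
    intro i h0
    have := hnorm i
    rw [h0] at this
    simp at this
    exact hs i this
  let w : Fin (l + 1) → ℂ := fun i =>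
    ((a i * (Real.cos (a i * η) / Real.sin (a i * η)) : ℝ) : ℂ) - Complex.I * (a i : ℂ)
  have hw : ∀ i, α i * w i = 2 * Complex.I * a i *
      Complex.exp (-(2 * Complex.I * (a i : ℂ) * (η : ℂ))) := by
    intro i
    simp only [hα, hexp, w]
    have h0 := hs i
    have h2 : Real.cos (a i * η) ^ 2 = 1 - Real.sin (a i * η) ^ 2 := by
      linarith [Real.sin_sq_add_cos_sq (a i * η)]
    have key1 : (1 - Real.cos (2 * (a i * η))) = 2 * Real.sin (a i * η) ^ 2 := by
      rw [Real.cos_two_mul]; linarith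
    apply Complex.ext
    · simp only [Complex.sub_re, Complex.sub_im, Complex.mul_re, Complex.mul_im, Complex.I_re,
        Complex.I_im, Complex.ofReal_re, Complex.ofReal_im, Complex.one_re, Complex.one_im,
        Complex.re_ofNat, Complex.im_ofNat, zero_mul, one_mul, mul_zero, mul_one, sub_zero,
        zero_sub, add_zero, zero_add, sub_self]
      rw [key1, Real.sin_two_mul]
      field_simp
      ring
    · simp only [Complex.sub_re, Complex.sub_im, Complex.mul_re, Complex.mul_im, Complex.I_re,
        Complex.I_im, Complex.ofReal_re, Complex.ofReal_im, Complex.one_re, Complex.one_im,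
        Complex.re_ofNat, Complex.im_ofNat, zero_mul, one_mul, mul_zero, mul_one, sub_zero,
        zero_sub, add_zero, zero_add, sub_self]
      rw [key1, Real.sin_two_mul, Real.cos_two_mul]
      field_simp
      linear_combination (-a i) * h2
  have hL := det_aux9 ((fderiv ℝ (fun q : Heis l k => Psi l k a q.1 q.2) (u, η) : Heis l k →L[ℝ] Heis l k) :
    Heis l k →ₗ[ℝ] Heis l k) (blockMul l k α) (blockMul l k (fun i => (α i)⁻¹))
    (fun v => by ext i j; simp [blockMul, hα0 i])
    (fun v => by ext i j; simp [blockMul, hα0 i])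
    _ (fun v s => psi_fst l k a u v η s)
  unfold jacPsi
  rw [hL, det_blockMul]
  simp only [hnorm]
  congr 1
  have hB : -(blockMul l k (fun i => (α i)⁻¹)) (fun i j => 2 * Complex.I * a i *
        Complex.exp (-(2 * Complex.I * (a i : ℂ) * (η : ℂ))) * u i j) =
      (fun i j => - (w i * u i j)) := by
    ext i j
    simp only [← hw]
    simp only [blockMul, LinearMap.coe_mk, AddHom.coe_mk, Pi.neg_apply]
    have := hα0 i
    field_simp
  rw [hB]
  refine (psi_snd l k a u η w).trans ?_
  refine Finset.sum_congr rfl fun j _ => ?_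
  have hre : (w j).re = a j * (Real.cos (a j * η) / Real.sin (a j * η)) := by
    simp only [w, Complex.sub_re, Complex.mul_re, Complex.I_re,
      Complex.I_im, Complex.ofReal_re, Complex.ofReal_im]
    ring
  have h0 := hs j
  have h2 : Real.cos (a j * η) ^ 2 = 1 - Real.sin (a j * η) ^ 2 := by
    linarith [Real.sin_sq_add_cos_sq (a j * η)]
  rw [hre, show 2 * a j * η = 2 * (a j * η) by ring, Real.cos_two_mul, Real.sin_two_mul, mul_assoc]
  congr 1
  field_simp
  ring_nf

lemma sin_low {x : ℝ} (h0 : 0 < x) (h1 : x < π) : 2 / π ^ 2 * (x * (π - x)) ≤ Real.sin x := by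
  have hp := Real.pi_pos
  rcases le_total x (π / 2) with h | h
  · refine le_trans ?_ (Real.mul_le_sin h0.le h)
    rw [div_mul_eq_mul_div, div_mul_eq_mul_div, div_le_div_iff₀ (by positivity) hp]
    nlinarith [mul_pos h0 hp, mul_pos (mul_pos h0 hp) h0]
  · have := Real.mul_le_sin (x := π - x) (by linarith) (by linarith)
    rw [Real.sin_pi_sub] at this
    refine le_trans ?_ this
    have h3 : 0 < π - x := by linarith
    rw [div_mul_eq_mul_div, div_mul_eq_mul_div, div_le_div_iff₀ (by positivity) hp]
    nlinarith [mul_pos h3 hp, mul_pos (mul_pos h3 hp) h3]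

lemma sin_up {x : ℝ} (h0 : 0 < x) (h1 : x < π) : Real.sin x ≤ x * (π - x) := by
  have hp := Real.pi_gt_three
  have h3 : 0 < π - x := by linarith
  rcases le_total x (π / 2) with h | h
  · refine le_trans (Real.sin_le h0.le) ?_
    nlinarith
  · have := Real.sin_le h3.le
    rw [Real.sin_pi_sub] at this
    nlinarith

lemma g_deriv (x : ℝ) :
    HasDerivAt (fun x => Real.sin x - x * Real.cos x) (x * Real.sin x) x := by
  refine ((Real.hasDerivAt_sin x).sub ((hasDerivAt_id x).mul (Real.hasDerivAt_cos x))).congr_deriv ?_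
  simp

lemma g_up {x : ℝ} (h0 : 0 ≤ x) : Real.sin x - x * Real.cos x ≤ x ^ 3 := by
  have hm : MonotoneOn (fun x => x ^ 3 - (Real.sin x - x * Real.cos x)) (Set.Ici 0) := by
    apply monotoneOn_of_hasDerivWithinAt_nonneg (convex_Ici 0) (f' := fun x => 3 * x ^ 2 - x * Real.sin x)
    · fun_prop
    · intro x hx
      have := ((hasDerivAt_pow 3 x).fun_sub (g_deriv x)).hasDerivWithinAt (s := interior (Set.Ici 0))
      simpa using this
    · intro x hx
      simp at hx
      have := Real.sin_le hx.le
      nlinarith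
  have := hm (Set.mem_Ici.2 le_rfl) (Set.mem_Ici.2 h0) h0
  simp at this
  linarith

lemma g_low {x : ℝ} (h0 : 0 < x) (h1 : x < π) :
    1 / π ^ 3 * x ^ 3 ≤ Real.sin x - x * Real.cos x := by
  have hp := Real.pi_gt_three
  rcases le_total x (π / 2) with h | h
  · have hm : MonotoneOn (fun x => (Real.sin x - x * Real.cos x) - 1 / π ^ 3 * x ^ 3)
        (Set.Icc 0 (π / 2)) := by
      apply monotoneOn_of_hasDerivWithinAt_nonneg (convex_Icc _ _)
        (f' := fun x => x * Real.sin x - 1 / π ^ 3 * (3 * x ^ 2))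
      · fun_prop
      · intro x hx
        have := ((g_deriv x).fun_sub ((hasDerivAt_pow 3 x).const_mul (1 / π ^ 3))).hasDerivWithinAt
          (s := interior (Set.Icc 0 (π / 2)))
        simpa using this
      · intro x hx
        rw [interior_Icc] at hx
        have h2 := Real.mul_le_sin hx.1.le hx.2.le
        have h3 : 3 * (1 / π ^ 3) ≤ 2 / π := by
          rw [mul_one_div, div_le_div_iff₀ (by positivity) (by positivity)]
          nlinarith [mul_pos Real.pi_pos Real.pi_pos, mul_pos (mul_pos Real.pi_pos Real.pi_pos) Real.pi_pos]
        have h4 := mul_le_mul_of_nonneg_left h2 hx.1.le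
        have h5 := mul_le_mul_of_nonneg_right h3 (sq_nonneg x)
        simp only [ge_iff_le]
        nlinarith
    have := hm (Set.mem_Icc.2 ⟨le_rfl, by linarith⟩) (Set.mem_Icc.2 ⟨h0.le, h⟩) h0.le
    simp at this
    simp only [one_div]
    linarith
  · have hs := Real.sin_nonneg_of_nonneg_of_le_pi h0.le h1.le
    have hc := Real.cos_nonpos_of_pi_div_two_le_of_le h (by linarith)
    have h2 : 1 ≤ Real.sin x - x * Real.cos x := by
      nlinarith [Real.sin_sq_add_cos_sq x, Real.sin_le_one x, Real.neg_one_le_cos x]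
    refine le_trans ?_ h2
    rw [one_div_mul_eq_div, div_le_one (by positivity)]
    exact pow_le_pow_left₀ h0.le h1.le 3

/-- ratio bounds -/
lemma h_bounds {x : ℝ} (h0 : 0 < x) (h1 : x < π) :
    1 / π ^ 3 * x ^ 2 ≤ (Real.sin x - x * Real.cos x) / Real.sin x * (π - x) ∧
    (Real.sin x - x * Real.cos x) / Real.sin x * (π - x) ≤ π ^ 2 / 2 * x ^ 2 := by
  have hs := Real.sin_pos_of_pos_of_lt_pi h0 h1
  have hp := Real.pi_pos
  have h3 : 0 < π - x := by linarith
  rw [div_mul_eq_mul_div _ (Real.sin x), le_div_iff₀ hs, div_le_iff₀ hs]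
  constructor
  · calc 1 / π ^ 3 * x ^ 2 * Real.sin x ≤ 1 / π ^ 3 * x ^ 2 * (x * (π - x)) := by
          gcongr; exact sin_up h0 h1
      _ = (1 / π ^ 3 * x ^ 3) * (π - x) := by ring
      _ ≤ _ := by gcongr; exact g_low h0 h1
  · calc (Real.sin x - x * Real.cos x) * (π - x) ≤ x ^ 3 * (π - x) := by
          gcongr; exact g_up h0.le
      _ = π ^ 2 / 2 * x ^ 2 * (2 / π ^ 2 * (x * (π - x))) := by field_simp
      _ ≤ _ := by gcongr; exact sin_low h0 h1

/-- Bounds for one block: either `a = 1` and the weight is `π - |η|`, or `a < 1` and it is `1`. -/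
lemma block_bounds (a : ℝ) (ha : 0 < a) (P : Prop) [Decidable P] (hP : P → a = 1)
    (hP' : ¬ P → a < 1) :
    ∃ c C : ℝ, 0 < c ∧ 0 < C ∧ ∀ η : ℝ, 0 < |η| → |η| < π →
      (c * (|η| ^ 2 * (if P then π - |η| else 1) ^ 2) ≤ 4 * Real.sin (a * η) ^ 2 ∧
       4 * Real.sin (a * η) ^ 2 ≤ C * (|η| ^ 2 * (if P then π - |η| else 1) ^ 2)) ∧
      (c * |η| ^ 2 ≤ 8 * a ^ 2 * ((Real.sin (a * η) - a * η * Real.cos (a * η)) / Real.sin (a * η))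
          * (if P then π - |η| else 1) ∧
        8 * a ^ 2 * ((Real.sin (a * η) - a * η * Real.cos (a * η)) / Real.sin (a * η))
          * (if P then π - |η| else 1) ≤ C * |η| ^ 2) := by
  have hp := Real.pi_pos
  have red : ∀ η : ℝ, Real.sin (a * η) ^ 2 = Real.sin (a * |η|) ^ 2 ∧
      (Real.sin (a * η) - a * η * Real.cos (a * η)) / Real.sin (a * η) =
      (Real.sin (a * |η|) - a * |η| * Real.cos (a * |η|)) / Real.sin (a * |η|) := by
    intro η
    rcases abs_choice η with h | h <;> rw [h]
    · simp
    · rw [mul_neg, Real.sin_neg, Real.cos_neg]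
      refine ⟨by ring, ?_⟩
      rw [div_neg, ← neg_div]; congr 1; ring
  have ha1 : a ≤ 1 := by
    by_cases h : P
    · exact (hP h).le
    · exact (hP' h).le
  obtain ⟨m, M, hm, hM, hw⟩ : ∃ m M : ℝ, 0 < m ∧ 0 < M ∧ ∀ t : ℝ, 0 < t → t < π →
      m * (if P then π - t else 1) ≤ π - a * t ∧ π - a * t ≤ M * (if P then π - t else 1) := by
    by_cases h : P
    · refine ⟨1, 1, one_pos, one_pos, fun t _ _ => ?_⟩
      simp [h, hP h]
    · have := hP' h
      refine ⟨π * (1 - a), π, mul_pos hp (by linarith), hp, fun t h1 h2 => ?_⟩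
      simp only [h, if_false]
      constructor <;> nlinarith
  have hpos : ∀ t : ℝ, t < π → 0 < (if P then π - t else 1) := by
    intro t ht; split_ifs <;> linarith
  refine ⟨min (4 * (2 / π ^ 2 * (a * m)) ^ 2) (8 * a ^ 2 * (1 / π ^ 3 * a ^ 2) / M),
    max (4 * (a * M) ^ 2) (8 * a ^ 2 * (π ^ 2 / 2 * a ^ 2) / m), by positivity, by positivity, ?_⟩
  intro η h0 h1
  rw [(red η).1, (red η).2]
  generalize |η| = t at *
  have hW := hpos t h1
  obtain ⟨hw1, hw2⟩ := hw t h0 h1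
  generalize (if P then π - t else 1) = W at *
  have hx0 : 0 < a * t := by positivity
  have hx1 : a * t < π := by nlinarith
  have hx2 : 0 < π - a * t := by linarith
  have hs := Real.sin_pos_of_pos_of_lt_pi hx0 hx1
  obtain ⟨hb1, hb2⟩ := h_bounds hx0 hx1
  set H := (Real.sin (a * t) - a * t * Real.cos (a * t)) / Real.sin (a * t) with hH
  have hH0 : 0 ≤ H := by
    by_contra hn
    push Not at hn
    have : 0 < 1 / π ^ 3 * (a * t) ^ 2 := by positivity
    nlinarith
  refine ⟨⟨?_, ?_⟩, ?_, ?_⟩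
  · refine (mul_le_mul_of_nonneg_right (min_le_left _ _) (by positivity)).trans ?_
    calc 4 * (2 / π ^ 2 * (a * m)) ^ 2 * (t ^ 2 * W ^ 2)
        = 4 * (2 / π ^ 2 * (a * t * (m * W))) ^ 2 := by ring
      _ ≤ 4 * (2 / π ^ 2 * (a * t * (π - a * t))) ^ 2 := by gcongr
      _ ≤ _ := by gcongr; exact sin_low hx0 hx1
  · refine le_trans ?_ (mul_le_mul_of_nonneg_right (le_max_left _ _) (by positivity))
    calc 4 * Real.sin (a * t) ^ 2 ≤ 4 * (a * t * (π - a * t)) ^ 2 := by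
          gcongr; exact sin_up hx0 hx1
      _ ≤ 4 * (a * t * (M * W)) ^ 2 := by gcongr
      _ = _ := by ring
  · refine (mul_le_mul_of_nonneg_right (min_le_right _ _) (by positivity)).trans ?_
    rw [div_mul_eq_mul_div, div_le_iff₀ hM]
    calc 8 * a ^ 2 * (1 / π ^ 3 * a ^ 2) * t ^ 2
        = 8 * a ^ 2 * (1 / π ^ 3 * (a * t) ^ 2) := by ring
      _ ≤ 8 * a ^ 2 * (H * (π - a * t)) := by gcongr
      _ ≤ 8 * a ^ 2 * (H * (M * W)) := by gcongr
      _ = _ := by ring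
  · refine le_trans ?_ (mul_le_mul_of_nonneg_right (le_max_right _ _) (by positivity))
    rw [div_mul_eq_mul_div, le_div_iff₀ hm]
    calc 8 * a ^ 2 * H * W * m = 8 * a ^ 2 * (H * (m * W)) := by ring
      _ ≤ 8 * a ^ 2 * (H * (π - a * t)) := by gcongr
      _ ≤ 8 * a ^ 2 * (π ^ 2 / 2 * (a * t) ^ 2) := by gcongr
      _ = _ := by ring

/-- For all `u` and `0 < |η| < π`, the Jacobian determinant of `Ψ` satisfies
the two-sided bound `J(u,η) ∼ |η|^{2n+2} (π−|η|)^{2k_l−1} (|u′|²(π−|η|) + |u_l|²)`, where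
`u′ = (u₁,…,u_{l−1})` and the implied constants depend only on `(𝒦,𝒜)`. -/
theorem statement9 (l : ℕ) (k : Fin (l + 1) → ℕ) (hk : ∀ i, 0 < k i)
    (a : Fin (l + 1) → ℝ) (ha0 : 0 < a 0) (haMono : StrictMono a)
    (haLast : a (Fin.last l) = 1) :
    ∃ c C : ℝ, 0 < c ∧ 0 < C ∧
      ∀ (u : (i : Fin (l + 1)) → Fin (k i) → ℂ) (η : ℝ), 0 < |η| → |η| < Real.pi →
        c * (|η| ^ (2 * (∑ i, k i) + 2) *
              (Real.pi - |η|) ^ (2 * k (Fin.last l) - 1) *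
              ((∑ j ∈ Finset.univ.erase (Fin.last l), zNormSq l k u j) * (Real.pi - |η|) +
                zNormSq l k u (Fin.last l))) ≤ jacPsi l k a u η ∧
        jacPsi l k a u η ≤
          C * (|η| ^ (2 * (∑ i, k i) + 2) *
              (Real.pi - |η|) ^ (2 * k (Fin.last l) - 1) *
              ((∑ j ∈ Finset.univ.erase (Fin.last l), zNormSq l k u j) * (Real.pi - |η|) +
                zNormSq l k u (Fin.last l))) := by
  classical
  have hpos : ∀ i, 0 < a i := fun i => lt_of_lt_of_le ha0 (haMono.monotone (Fin.zero_le i))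
  have hlt : ∀ i, ¬ i = Fin.last l → a i < 1 := fun i hi => by
    rw [← haLast]; exact haMono (Fin.lt_last_iff_ne_last.2 hi)
  choose c C hc hC hb using fun i => block_bounds (a i) (hpos i) (i = Fin.last l)
    (fun h => by rw [h, haLast]) (hlt i)
  obtain ⟨c0, hc0, hc0le⟩ : ∃ c0 : ℝ, 0 < c0 ∧ ∀ i, c0 ≤ c i := by
    obtain ⟨i, hi⟩ := Finite.exists_min c
    exact ⟨c i, hc i, hi⟩
  obtain ⟨C0, hC0, hC0le⟩ : ∃ C0 : ℝ, 0 < C0 ∧ ∀ i, C i ≤ C0 := by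
    obtain ⟨i, hi⟩ := Finite.exists_max C
    exact ⟨C i, hC i, hi⟩
  refine ⟨(∏ i, c i ^ k i) * c0, (∏ i, C i ^ k i) * C0,
    mul_pos (Finset.prod_pos fun i _ => pow_pos (hc i) _) hc0,
    mul_pos (Finset.prod_pos fun i _ => pow_pos (hC i) _) hC0, ?_⟩
  intro u η h0 h1
  have hs : ∀ i, Real.sin (a i * η) ≠ 0 := by
    intro i hi
    have := (hb i η h0 h1).1.1
    have hW : 0 < (if i = Fin.last l then π - |η| else 1) := by split_ifs <;> linarith
    rw [hi] at this
    have h3 : 0 < c i * (|η| ^ 2 * (if i = Fin.last l then π - |η| else 1) ^ 2) :=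
      mul_pos (hc i) (by positivity)
    simp only [ne_eq, OfNat.ofNat_ne_zero, not_false_eq_true, zero_pow, mul_zero] at this
    linarith
  rw [jac_formula l k a u η hs]
  have hz : ∀ j, 0 ≤ zNormSq l k u j := fun j =>
    Finset.sum_nonneg fun m _ => Complex.normSq_nonneg _
  have hD : 0 < π - |η| := by linarith
  have hb' := fun i => hb i η h0 h1
  clear hb
  generalize |η| = t at *
  set D := π - t with hDdef
  set W : Fin (l + 1) → ℝ := fun i => if i = Fin.last l then D else 1 with hWdef
  have hW : ∀ i, 0 < W i := by intro i; simp only [hWdef]; split_ifs <;> linarith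
  set S := (∑ j ∈ Finset.univ.erase (Fin.last l), zNormSq l k u j) * D +
    zNormSq l k u (Fin.last l) with hS
  have hprod : ∀ e : Fin (l + 1) → ℝ, ∏ i, (e i * (t ^ 2 * W i ^ 2)) ^ k i =
      (∏ i, e i ^ k i) * (t ^ (2 * ∑ i, k i) * D ^ (2 * k (Fin.last l))) := by
    intro e
    simp only [mul_pow, Finset.prod_mul_distrib, ← pow_mul, Finset.prod_pow_eq_pow_sum,
      Finset.mul_sum]
    congr 2
    rw [Finset.prod_eq_single (Fin.last l)]
    · simp [hWdef]
    · intro i _ hi; simp [hWdef, hi]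
    · simp
  set F : Fin (l + 1) → ℝ := fun j => 8 * a j ^ 2 *
        ((Real.sin (a j * η) - a j * η * Real.cos (a j * η)) / Real.sin (a j * η)) with hF
  have hSW : S = ∑ j, zNormSq l k u j * (D / W j) := by
    rw [← Finset.sum_erase_add _ _ (Finset.mem_univ (Fin.last l)), hS, Finset.sum_mul]
    congr 1
    · refine Finset.sum_congr rfl fun j hj => ?_
      simp [hWdef, Finset.ne_of_mem_erase hj]
    · simp [hWdef, hD.ne']
  have hsum1 : c0 * t ^ 2 * S ≤ (∑ j, zNormSq l k u j * F j) * D := by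
    rw [hSW, Finset.mul_sum, Finset.sum_mul]
    refine Finset.sum_le_sum fun j _ => ?_
    have h2 : c j * t ^ 2 ≤ F j * W j := (hb' j).2.1
    have h3 : c0 * t ^ 2 ≤ F j * W j := le_trans (by gcongr; exact hc0le j) h2
    calc c0 * t ^ 2 * (zNormSq l k u j * (D / W j))
        ≤ F j * W j * (zNormSq l k u j * (D / W j)) :=
          mul_le_mul_of_nonneg_right h3 (mul_nonneg (hz j) (div_pos hD (hW j)).le)
      _ = _ := by have := (hW j).ne'; field_simp
  have hsum2 : (∑ j, zNormSq l k u j * F j) * D ≤ C0 * t ^ 2 * S := by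
    rw [hSW, Finset.mul_sum, Finset.sum_mul]
    refine Finset.sum_le_sum fun j _ => ?_
    have h2 : F j * W j ≤ C j * t ^ 2 := (hb' j).2.2
    have h3 : F j * W j ≤ C0 * t ^ 2 := h2.trans (by gcongr; exact hC0le j)
    calc zNormSq l k u j * F j * D = F j * W j * (zNormSq l k u j * (D / W j)) := by
          have := (hW j).ne'; field_simp
      _ ≤ _ := mul_le_mul_of_nonneg_right h3 (mul_nonneg (hz j) (div_pos hD (hW j)).le)
  have hp1 : (∏ i, c i ^ k i) * (t ^ (2 * ∑ i, k i) * D ^ (2 * k (Fin.last l))) ≤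
      ∏ i, (4 * Real.sin (a i * η) ^ 2) ^ k i := by
    rw [← hprod]
    exact Finset.prod_le_prod
      (fun i _ => pow_nonneg (mul_nonneg (hc i).le (by positivity)) _)
      (fun i _ => pow_le_pow_left₀ (mul_nonneg (hc i).le (by positivity)) (hb' i).1.1 _)
  have hp2 : ∏ i, (4 * Real.sin (a i * η) ^ 2) ^ k i ≤
      (∏ i, C i ^ k i) * (t ^ (2 * ∑ i, k i) * D ^ (2 * k (Fin.last l))) := by
    rw [← hprod]
    exact Finset.prod_le_prod (fun i _ => by positivity)
      (fun i _ => pow_le_pow_left₀ (by positivity) (hb' i).1.2 _)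
  have hS0 : 0 ≤ S := by
    rw [hSW]
    exact Finset.sum_nonneg fun j _ => mul_nonneg (hz j) (div_pos hD (hW j)).le
  have hpc : 0 < ∏ i, c i ^ k i := Finset.prod_pos fun i _ => pow_pos (hc i) _
  have hpC : 0 < ∏ i, C i ^ k i := Finset.prod_pos fun i _ => pow_pos (hC i) _
  have hkD : D ^ (2 * k (Fin.last l)) = D ^ (2 * k (Fin.last l) - 1) * D := by
    rw [← pow_succ]; congr 1; have := hk (Fin.last l); omega
  generalize (∑ j, zNormSq l k u j * F j) = Q at *
  generalize (∏ i, (4 * Real.sin (a i * η) ^ 2) ^ k i) = R at *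
  generalize (∏ i, c i ^ k i) = pc at *
  generalize (∏ i, C i ^ k i) = pC at *
  have hQ0 : 0 ≤ Q * D := le_trans (by positivity) hsum1
  constructor
  · refine le_of_mul_le_mul_right ?_ hD
    calc _ = (pc * (t ^ (2 * ∑ i, k i) * D ^ (2 * k (Fin.last l)))) * (c0 * t ^ 2 * S) := by
          rw [hkD]; ring
      _ ≤ R * (Q * D) := mul_le_mul hp1 hsum1 (by positivity) (le_trans (by positivity) hp1)
      _ = _ := by ring
  · refine le_of_mul_le_mul_right ?_ hD
    calc R * Q * D = R * (Q * D) := by ring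
      _ ≤ (pC * (t ^ (2 * ∑ i, k i) * D ^ (2 * k (Fin.last l)))) * (C0 * t ^ 2 * S) :=
          mul_le_mul hp2 hsum2 hQ0 (by positivity)
      _ = _ := by rw [hkD]; ring


end
end
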